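/- For every n ≥ 3, the center of the braid group B_n is the infinite cyclic subgroup generated by Δ_n²: the center equals the set of integer powers of Δ_n², and Δ_n² has infinite order in B_n. -/

import Mathlib

/-- The set of relators for Artin's classical presentation of the braid group `Bₙ`:
generators `σ₁, …, σ_{n-1}` (indexed by `Fin (n-1)`), with relations
`σᵢ σₖ = σₖ σᵢ` when `|i - k| ≥ 2` and `σᵢ σ_{i+1} σᵢ = σ_{i+1} σᵢ σ_{i+1}`. -/
def braidRels (n : ℕ) : Set (FreeGroup (Fin (n - 1))) :=
  {w | (∃ i k : Fin (n - 1), (i : ℕ) + 2 ≤ (k : ℕ) ∧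
          w = FreeGroup.of i * FreeGroup.of k * (FreeGroup.of k * FreeGroup.of i)⁻¹) ∨
       (∃ i k : Fin (n - 1), (i : ℕ) + 1 = (k : ℕ) ∧
          w = FreeGroup.of i * FreeGroup.of k * FreeGroup.of i *
              (FreeGroup.of k * FreeGroup.of i * FreeGroup.of k)⁻¹)}

/-- The braid group `Bₙ`, given by Artin's classical presentation. -/
abbrev BraidGroup (n : ℕ) : Type := PresentedGroup (braidRels n)

/-- The generator `σ_{i+1}` of `Bₙ` for a natural-number index `i < n - 1`
(junk value `1` otherwise). -/
def sigmaB (n : ℕ) (i : ℕ) : BraidGroup n :=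
  if h : i < n - 1 then PresentedGroup.of (⟨i, h⟩ : Fin (n - 1)) else 1

/-- The Garside element
`Δₙ = (σ_{n-1} ⋯ σ₁)(σ_{n-1} ⋯ σ₂) ⋯ (σ_{n-1} σ_{n-2})(σ_{n-1}) ∈ Bₙ`
(written with the 0-indexed Lean generators `x_j = σ_{j+1}`). -/
def deltaB (n : ℕ) : BraidGroup n :=
  ((List.range (n - 1)).map fun k =>
    ((List.range (n - 1 - k)).map fun j => sigmaB n (n - 2 - j)).prod).prod


/-- Artin's relations on words in `N` generators. -/
inductive BraidMonoidRel (N : ℕ) : FreeMonoid (Fin N) → FreeMonoid (Fin N) → Prop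
  | comm (i j : Fin N) (h : (i : ℕ) + 2 ≤ j) :
      BraidMonoidRel N (.of i * .of j) (.of j * .of i)
  | braid (i j : Fin N) (h : (i : ℕ) + 1 = j) :
      BraidMonoidRel N (.of i * .of j * .of i) (.of j * .of i * .of j)

/-- The monoid of positive braids on `N` generators. -/
abbrev BraidMonoid (N : ℕ) : Type := PresentedMonoid (BraidMonoidRel N)

namespace BraidMonoid

variable {N : ℕ}

/-- The generators of the positive braid monoid. -/
def gen (i : Fin N) : BraidMonoid N := PresentedMonoid.of _ i

/-- Word length as a homomorphism. -/
def lenHom (N : ℕ) : BraidMonoid N →* Multiplicative ℕ :=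
  PresentedMonoid.lift (fun _ => Multiplicative.ofAdd 1) (by
    rintro _ _ (⟨i, j, h⟩ | ⟨i, j, h⟩) <;> simp)

/-- Word length of a positive braid. -/
def len (a : BraidMonoid N) : ℕ := (lenHom N a).toAdd

@[simp] lemma len_one : len (1 : BraidMonoid N) = 0 := by simp [len]

@[simp] lemma len_mul (a b : BraidMonoid N) : len (a * b) = len a + len b := by simp [len]

@[simp] lemma len_gen (i : Fin N) : len (gen i) = 1 := by
  simp [len, lenHom, gen]

lemma gen_comm {i j : Fin N} (h : (i : ℕ) + 2 ≤ j ∨ (j : ℕ) + 2 ≤ i) :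
    gen i * gen j = gen j * gen i := by
  rcases h with h | h
  · exact PresentedMonoid.mk_eq_mk_of_rel (.comm i j h)
  · exact (PresentedMonoid.mk_eq_mk_of_rel (.comm j i h)).symm

lemma gen_braid {i j : Fin N} (h : (i : ℕ) + 1 = j ∨ (j : ℕ) + 1 = i) :
    gen i * (gen j * gen i) = gen j * (gen i * gen j) := by
  simp only [← mul_assoc]
  rcases h with h | h
  · exact PresentedMonoid.mk_eq_mk_of_rel (.braid i j h)
  · exact (PresentedMonoid.mk_eq_mk_of_rel (.braid j i h)).symm

lemma gen_comm_mul {i j : Fin N} (h : (i : ℕ) + 2 ≤ j ∨ (j : ℕ) + 2 ≤ i) (w : BraidMonoid N) :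
    gen i * (gen j * w) = gen j * (gen i * w) := by
  rw [← mul_assoc, gen_comm h, mul_assoc]

lemma gen_braid_mul {i j : Fin N} (h : (i : ℕ) + 1 = j ∨ (j : ℕ) + 1 = i) (w : BraidMonoid N) :
    gen i * (gen j * (gen i * w)) = gen j * (gen i * (gen j * w)) := by
  have := congrArg (· * w) (gen_braid h)
  simpa only [mul_assoc] using this

/-- `Cofactor i j a b` says that `gen i * a = gen j * b` holds because both sides are the same
multiple of the least common right multiple of `gen i` and `gen j`. -/
def Cofactor (i j : Fin N) (a b : BraidMonoid N) : Prop :=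
  (i = j ∧ a = b) ∨
  (((i : ℕ) + 2 ≤ j ∨ (j : ℕ) + 2 ≤ i) ∧ ∃ w, a = gen j * w ∧ b = gen i * w) ∨
  (((i : ℕ) + 1 = j ∨ (j : ℕ) + 1 = i) ∧
    ∃ w, a = gen j * (gen i * w) ∧ b = gen i * (gen j * w))

lemma Cofactor.symm {i j : Fin N} {a b : BraidMonoid N} (h : Cofactor i j a b) :
    Cofactor j i b a := by
  rcases h with ⟨h, e⟩ | ⟨h, w, e, f⟩ | ⟨h, w, e, f⟩
  · exact .inl ⟨h.symm, e.symm⟩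
  · exact .inr (.inl ⟨h.symm, w, f, e⟩)
  · exact .inr (.inr ⟨h.symm, w, f, e⟩)

lemma Cofactor.mul_right {i j : Fin N} {a b : BraidMonoid N} (h : Cofactor i j a b)
    (c : BraidMonoid N) : Cofactor i j (a * c) (b * c) := by
  rcases h with ⟨h, e⟩ | ⟨h, w, e, f⟩ | ⟨h, w, e, f⟩
  · exact .inl ⟨h, by rw [e]⟩
  · exact .inr (.inl ⟨h, w * c, by rw [e, mul_assoc], by rw [f, mul_assoc]⟩)
  · exact .inr (.inr ⟨h, w * c, by simp only [e, mul_assoc], by simp only [f, mul_assoc]⟩)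

/-- Equations `gen i * a = gen j * b` with `a` of length below `n` come from least common
multiples. -/
def CofactorBelow (N n : ℕ) : Prop :=
  ∀ (i j : Fin N) (a b : BraidMonoid N), len a < n → gen i * a = gen j * b → Cofactor i j a b

section

variable {n : ℕ} (H : CofactorBelow N n) {i j k : Fin N} {a b : BraidMonoid N}
include H

lemma CofactorBelow.cancel (ha : len a < n) (h : gen i * a = gen i * b) : a = b := by
  rcases H i i a b ha h with ⟨-, e⟩ | ⟨h, -⟩ | ⟨h, -⟩
  · exact e
  · omega
  · omega

lemma CofactorBelow.far (ha : len a < n) (h : gen i * a = gen j * b)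
    (hij : (i : ℕ) + 2 ≤ j ∨ (j : ℕ) + 2 ≤ i) : ∃ w, a = gen j * w ∧ b = gen i * w := by
  rcases H i j a b ha h with ⟨e, -⟩ | ⟨-, h⟩ | ⟨h, -⟩
  · subst e; omega
  · exact h
  · omega

lemma CofactorBelow.adj (ha : len a < n) (h : gen i * a = gen j * b)
    (hij : (i : ℕ) + 1 = j ∨ (j : ℕ) + 1 = i) :
    ∃ w, a = gen j * (gen i * w) ∧ b = gen i * (gen j * w) := by
  rcases H i j a b ha h with ⟨e, -⟩ | ⟨h, -⟩ | ⟨-, h⟩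
  · subst e; omega
  · omega
  · exact h

/-- Cube condition when `k` commutes with `i` and `j`. -/
lemma CofactorBelow.trans_far_far {U V : BraidMonoid N} (hU : len U < n)
    (hik : (i : ℕ) + 2 ≤ k ∨ (k : ℕ) + 2 ≤ i) (hkj : (k : ℕ) + 2 ≤ j ∨ (j : ℕ) + 2 ≤ k)
    (h : gen i * U = gen j * V) : Cofactor i j (gen k * U) (gen k * V) := by
  rcases H i j U V hU h with ⟨rfl, rfl⟩ | ⟨hij, w, rfl, rfl⟩ | ⟨hij, w, rfl, rfl⟩
  · exact .inl ⟨rfl, rfl⟩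
  · exact .inr (.inl ⟨hij, gen k * w, gen_comm_mul hkj w, gen_comm_mul hik.symm w⟩)
  · refine .inr (.inr ⟨hij, gen k * w, ?_, ?_⟩)
    · rw [gen_comm_mul hkj, gen_comm_mul hik.symm]
    · rw [gen_comm_mul hik.symm, gen_comm_mul hkj]

/-- Cube condition when `k` commutes with `i` and is adjacent to `j`. -/
lemma CofactorBelow.trans_far_adj {U V : BraidMonoid N} (hU : len U < n)
    (hik : (i : ℕ) + 2 ≤ k ∨ (k : ℕ) + 2 ≤ i) (hkj : (k : ℕ) + 1 = j ∨ (j : ℕ) + 1 = k)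
    (h : gen i * U = gen j * (gen k * V)) :
    Cofactor i j (gen k * U) (gen k * (gen j * V)) := by
  have hl := congrArg len h
  simp only [len_mul, len_gen] at hl
  have hne : i ≠ j := by rintro rfl; omega
  by_cases hij : (i : ℕ) + 2 ≤ j ∨ (j : ℕ) + 2 ≤ i
  · obtain ⟨W, rfl, h2⟩ := H.far hU h hij
    simp only [len_mul, len_gen] at *
    obtain ⟨W', rfl, rfl⟩ := H.far (by omega) h2 hik.symm
    refine .inr (.inl ⟨hij, gen k * (gen j * W'), ?_, ?_⟩)
    · rw [gen_braid_mul hkj]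
    · rw [← gen_comm_mul hij, gen_comm_mul hik.symm]
  · have hij' : (i : ℕ) + 1 = j ∨ (j : ℕ) + 1 = i := by
      have : (i : ℕ) ≠ j := fun e => hne (Fin.ext e)
      omega
    obtain ⟨W, rfl, h2⟩ := H.adj hU h hij'
    simp only [len_mul, len_gen] at *
    obtain ⟨P, rfl, h3⟩ := H.far (by omega) h2 hik.symm
    simp only [len_mul, len_gen] at *
    obtain ⟨Q, rfl, rfl⟩ := H.adj (by omega) h3 hkj.symm
    refine .inr (.inr ⟨hij', gen k * (gen j * (gen i * Q)), ?_, ?_⟩)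
    · rw [gen_comm_mul hik, gen_braid_mul hkj, ← gen_braid_mul hij', gen_comm_mul hik.symm]
    · rw [← gen_braid_mul hij', gen_comm_mul hik, gen_comm_mul hik.symm, gen_braid_mul hkj]

/-- Cube condition when `k` is adjacent to `i` and `j`. -/
lemma CofactorBelow.trans_adj_adj {U V : BraidMonoid N} (hU : len U + 1 < n)
    (hik : (i : ℕ) + 1 = k ∨ (k : ℕ) + 1 = i) (hkj : (k : ℕ) + 1 = j ∨ (j : ℕ) + 1 = k)
    (h : gen i * (gen k * U) = gen j * (gen k * V)) :
    Cofactor i j (gen k * (gen i * U)) (gen k * (gen j * V)) := by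
  have hl := congrArg len h
  simp only [len_mul, len_gen] at hl
  by_cases hne : i = j
  · subst hne
    have h1 := H.cancel (by simp only [len_mul, len_gen]; omega) h
    have h2 := H.cancel (by omega) h1
    exact .inl ⟨rfl, by rw [h2]⟩
  have hij : (i : ℕ) + 2 ≤ j ∨ (j : ℕ) + 2 ≤ i := by
    have : (i : ℕ) ≠ j := fun e => hne (Fin.ext e)
    omega
  obtain ⟨W, h1, h2⟩ := H.far (by simp only [len_mul, len_gen]; omega) h hij
  obtain ⟨P, rfl, rfl⟩ := H.adj (by omega) h1 hkj
  simp only [len_mul, len_gen] at *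
  obtain ⟨Q, rfl, h3⟩ := H.adj (by omega) h2 hik.symm
  simp only [len_mul, len_gen] at *
  have h4 := H.cancel (by simp only [len_mul, len_gen]; omega) h3
  obtain ⟨S, rfl, rfl⟩ := H.far (by omega) h4 hij.symm
  refine .inr (.inl ⟨hij, gen k * (gen j * (gen i * (gen k * S))), ?_, ?_⟩)
  · rw [gen_comm_mul hij, gen_braid_mul hik, gen_braid_mul hkj]
  · rw [gen_comm_mul hij.symm, gen_comm_mul hij.symm, ← gen_braid_mul hkj, ← gen_braid_mul hik]

lemma CofactorBelow.trans {c : BraidMonoid N} (ha : len a < n + 1) (h1 : Cofactor i k a c)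
    (h2 : Cofactor k j c b) : Cofactor i j a b := by
  rcases h1 with ⟨rfl, rfl⟩ | ⟨hik, U, rfl, rfl⟩ | ⟨hik, U, rfl, rfl⟩
  · exact h2
  · rcases h2 with ⟨rfl, rfl⟩ | ⟨hkj, V, e, rfl⟩ | ⟨hkj, V, e, rfl⟩
    · exact .inr (.inl ⟨hik, U, rfl, rfl⟩)
    · simp only [len_mul, len_gen] at *
      exact H.trans_far_far (by omega) hik hkj e
    · simp only [len_mul, len_gen] at *
      exact H.trans_far_adj (by omega) hik hkj e
  · rcases h2 with ⟨rfl, rfl⟩ | ⟨hkj, V, e, rfl⟩ | ⟨hkj, V, e, rfl⟩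
    · exact .inr (.inr ⟨hik, U, rfl, rfl⟩)
    · have hl := congrArg len e
      simp only [len_mul, len_gen] at *
      exact (H.trans_far_adj (by omega) hkj.symm hik.symm e.symm).symm
    · simp only [len_mul, len_gen] at *
      exact H.trans_adj_adj (by omega) hik hkj e

end

/-- Words that start with letters `i`, `j` and have tails related by `Cofactor i j`, or are both
empty. -/
def WordCofactor (x y : FreeMonoid (Fin N)) : Prop :=
  (x = 1 ∧ y = 1) ∨ ∃ i A j B, x = .of i * A ∧ y = .of j * B ∧
    Cofactor i j (PresentedMonoid.mk _ A) (PresentedMonoid.mk _ B)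

lemma WordCofactor.refl (x : FreeMonoid (Fin N)) : WordCofactor x x := by
  induction x using FreeMonoid.casesOn with
  | one => exact .inl ⟨rfl, rfl⟩
  | of_mul i A => exact .inr ⟨i, A, i, A, rfl, rfl, .inl ⟨rfl, rfl⟩⟩

lemma WordCofactor.symm {x y : FreeMonoid (Fin N)} (h : WordCofactor x y) :
    WordCofactor y x := by
  rcases h with ⟨h₁, h₂⟩ | ⟨i, A, j, B, h₁, h₂, h⟩
  · exact .inl ⟨h₂, h₁⟩
  · exact .inr ⟨j, B, i, A, h₂, h₁, h.symm⟩

lemma len_mk (x : FreeMonoid (Fin N)) :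
    len (PresentedMonoid.mk (BraidMonoidRel N) x) = x.length := by
  induction x with
  | one => simp
  | of i => exact len_gen i
  | mul x y hx hy => rw [map_mul, len_mul, hx, hy, FreeMonoid.length_mul]

lemma length_eq_of_conGen {x y : FreeMonoid (Fin N)} (h : ConGen.Rel (BraidMonoidRel N) x y) :
    x.length = y.length := by
  rw [← len_mk, ← len_mk, PresentedMonoid.mk_eq_mk_iff.2 h]

lemma wordCofactor_of_conGen {n : ℕ} (H : CofactorBelow N n) {x y : FreeMonoid (Fin N)}
    (h : ConGen.Rel (BraidMonoidRel N) x y) (hx : x.length < n + 2) : WordCofactor x y := by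
  induction h with
  | of x y h =>
    rcases h with ⟨i, j, h⟩ | ⟨i, j, h⟩
    · exact .inr ⟨i, .of j, j, .of i, rfl, rfl,
        .inr (.inl ⟨.inl h, 1, (mul_one _).symm, (mul_one _).symm⟩)⟩
    · exact .inr ⟨i, .of j * .of i, j, .of i * .of j, by rw [mul_assoc], by rw [mul_assoc],
        .inr (.inr ⟨.inl h, 1, by simp [gen, PresentedMonoid.of],
          by simp [gen, PresentedMonoid.of]⟩)⟩
  | refl x => exact .refl x
  | symm h ih =>
    exact (ih (by rwa [length_eq_of_conGen h])).symm
  | trans h₁ h₂ ih₁ ih₂ =>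
    have hy := length_eq_of_conGen h₁
    rcases ih₁ hx with ⟨rfl, rfl⟩ | ⟨i, A, k, C, rfl, rfl, hAC⟩
    · exact ih₂ hx
    · rcases ih₂ (by rwa [← hy]) with ⟨e, -⟩ | ⟨k', C', j, B, e, rfl, hCB⟩
      · have := congrArg FreeMonoid.length e
        simp at this
      · obtain ⟨rfl, rfl⟩ := List.cons_eq_cons.1 e
        refine .inr ⟨i, A, j, B, rfl, rfl, H.trans ?_ hAC hCB⟩
        rw [len_mk]
        simp only [FreeMonoid.length_mul, FreeMonoid.length_of] at hx
        omega
  | @mul x x' y y' h₁ h₂ ih₁ ih₂ =>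
    rw [FreeMonoid.length_mul] at hx
    have e : PresentedMonoid.mk (BraidMonoidRel N) y = PresentedMonoid.mk _ y' :=
      PresentedMonoid.mk_eq_mk_iff.2 h₂
    rcases ih₁ (by omega) with ⟨rfl, rfl⟩ | ⟨i, A, j, B, rfl, rfl, hAB⟩
    · simpa only [one_mul] using ih₂ (by omega)
    · refine .inr ⟨i, A * y, j, B * y', mul_assoc _ _ _, mul_assoc _ _ _, ?_⟩
      rw [map_mul, map_mul, ← e]
      exact hAB.mul_right _

lemma cofactorBelow (N n : ℕ) : CofactorBelow N n := by
  induction n with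
  | zero => exact fun i j a b h => absurd h (Nat.not_lt_zero _)
  | succ n H =>
    intro i j a b ha h
    obtain ⟨A, rfl⟩ := PresentedMonoid.surjective_mk a
    obtain ⟨B, rfl⟩ := PresentedMonoid.surjective_mk b
    have hrel : conGen (BraidMonoidRel N) (.of i * A) (.of j * B) :=
      PresentedMonoid.mk_eq_mk_iff.1 h
    rw [len_mk] at ha
    have hlen : (FreeMonoid.of i * A).length < n + 2 := by
      rw [FreeMonoid.length_mul, FreeMonoid.length_of]
      omega
    rcases wordCofactor_of_conGen H hrel hlen with ⟨e, -⟩ | ⟨i', A', j', B', e, f, hAB⟩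
    · have := congrArg FreeMonoid.length e
      simp at this
    · obtain ⟨rfl, rfl⟩ := List.cons_eq_cons.1 e
      obtain ⟨rfl, rfl⟩ := List.cons_eq_cons.1 f
      exact hAB

/-- Garside's theorem: least common right multiples of generators. -/
theorem cofactor_of_eq {i j : Fin N} {a b : BraidMonoid N} (h : gen i * a = gen j * b) :
    Cofactor i j a b :=
  cofactorBelow N _ i j a b (Nat.lt_succ_self _) h

lemma gen_cancel {i : Fin N} {a b : BraidMonoid N} (h : gen i * a = gen i * b) : a = b :=
  (cofactorBelow N _).cancel (Nat.lt_succ_self _) h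

lemma mul_left_cancel_of_eq (c : BraidMonoid N) {a b : BraidMonoid N} (h : c * a = c * b) :
    a = b := by
  obtain ⟨w, rfl⟩ := PresentedMonoid.surjective_mk c
  induction w generalizing a b with
  | one => simpa using h
  | of i => exact gen_cancel h
  | mul x y hx hy =>
    rw [map_mul, mul_assoc, mul_assoc] at h
    exact hy (hx h)

/-- The generators indexed by natural numbers, with value `1` out of range. -/
def natGen (N i : ℕ) : BraidMonoid N := if h : i < N then gen ⟨i, h⟩ else 1

lemma natGen_of_lt {i : ℕ} (h : i < N) : natGen N i = gen ⟨i, h⟩ := dif_pos h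

lemma natGen_comm {i j : ℕ} (hij : i + 2 ≤ j) :
    Commute (natGen N i) (natGen N j) := by
  by_cases hj : j < N
  · rw [natGen_of_lt hj, natGen_of_lt (by omega)]
    exact gen_comm (.inl hij)
  · rw [show natGen N j = 1 from dif_neg hj]
    exact Commute.one_right _

lemma natGen_braid {i : ℕ} (hi : i + 1 < N) (w : BraidMonoid N) :
    natGen N i * (natGen N (i + 1) * (natGen N i * w)) =
      natGen N (i + 1) * (natGen N i * (natGen N (i + 1) * w)) := by
  rw [natGen_of_lt hi, natGen_of_lt (by omega)]
  exact gen_braid_mul (.inl rfl) w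

/-- The ascending product of the first `m` generators. -/
def up (N : ℕ) : ℕ → BraidMonoid N
  | 0 => 1
  | m + 1 => up N m * natGen N m

/-- The descending product of the first `m` generators. -/
def down (N : ℕ) : ℕ → BraidMonoid N
  | 0 => 1
  | m + 1 => natGen N m * down N m

/-- The Garside element on the first `m` generators. -/
def garside (N : ℕ) : ℕ → BraidMonoid N
  | 0 => 1
  | m + 1 => up N (m + 1) * garside N m

lemma natGen_comm_up {j : ℕ} : ∀ {m : ℕ}, m + 1 ≤ j → Commute (natGen N j) (up N m)
  | 0, _ => Commute.one_right _
  | _ + 1, h => (natGen_comm_up (by omega)).mul_right (natGen_comm (by omega)).symm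

lemma natGen_comm_down {j : ℕ} : ∀ {m : ℕ}, m + 1 ≤ j → Commute (natGen N j) (down N m)
  | 0, _ => Commute.one_right _
  | _ + 1, h => (natGen_comm (by omega)).symm.mul_right (natGen_comm_down (by omega))

lemma natGen_comm_garside {j : ℕ} : ∀ {m : ℕ}, m + 1 ≤ j → Commute (natGen N j) (garside N m)
  | 0, _ => Commute.one_right _
  | _ + 1, h => (natGen_comm_up h).mul_right (natGen_comm_garside (by omega))

lemma garside_succ' (m : ℕ) : garside N (m + 1) = garside N m * down N (m + 1) := by
  induction m with
  | zero => simp [garside, up, down]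
  | succ m ih =>
    calc garside N (m + 2)
      _ = up N (m + 1) * (natGen N (m + 1) * garside N m) * down N (m + 1) := by
        simp only [garside.eq_2 N (m + 1), ih, up.eq_2 N (m + 1), mul_assoc]
      _ = garside N (m + 1) * down N (m + 2) := by
        rw [(natGen_comm_garside le_rfl).eq, down.eq_2 N (m + 1), garside]
        simp only [mul_assoc]

/-- Conjugation by an ascending product shifts generators. -/
lemma natGen_succ_mul_up {i m : ℕ} (hi : i + 1 < m) (hm : m ≤ N) :
    natGen N (i + 1) * up N m = up N m * natGen N i := by
  induction m, (show i + 2 ≤ m from hi) using Nat.le_induction with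
  | base =>
    have h := natGen_braid hm 1
    simp only [mul_one] at h
    simp only [up]
    rw [← mul_assoc, ← mul_assoc, (natGen_comm_up le_rfl).eq]
    simp only [mul_assoc, h]
  | succ m h ih =>
    rw [up, ← mul_assoc, ih (by omega) (by omega), mul_assoc, mul_assoc,
      (natGen_comm (by omega)).eq]

lemma natGen_mul_down {m : ℕ} (hm : m + 2 ≤ N) :
    natGen N m * down N (m + 2) = down N (m + 2) * natGen N (m + 1) := by
  simp only [down, mul_assoc]
  rw [natGen_braid hm, (natGen_comm_down le_rfl).eq]

/-- Conjugation by the Garside element reverses the order of the generators. -/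
lemma natGen_mul_garside {i m : ℕ} (hi : i < m) (hm : m ≤ N) :
    natGen N i * garside N m = garside N m * natGen N (m - 1 - i) := by
  induction m generalizing i with
  | zero => omega
  | succ m ih =>
    rcases i with _ | i
    · rcases m with _ | m
      · simp [garside, up]
      · rw [garside_succ', ← mul_assoc, ih (by omega) (by omega), mul_assoc, mul_assoc]
        exact congrArg _ (natGen_mul_down hm)
    · rw [garside, ← mul_assoc, natGen_succ_mul_up (by omega) hm, mul_assoc,
        ih (by omega) (by omega), mul_assoc]
      congr 3
      omega

/-- The Garside element is divisible by all generators involved. -/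
lemma natGen_dvd_garside {i m : ℕ} (hi : i < m) (hm : m ≤ N) : natGen N i ∣ garside N m := by
  induction m generalizing i with
  | zero => omega
  | succ m ih =>
    rcases Nat.lt_succ_iff_lt_or_eq.1 hi with h | rfl
    · rw [garside_succ']
      exact (ih h (by omega)).mul_right _
    · rcases i with _ | i
      · simp [garside, up]
      · obtain ⟨x, hx⟩ := ih (Nat.lt_succ_self i) (by omega)
        rw [garside, hx, ← mul_assoc, ← natGen_succ_mul_up (by omega) hm, mul_assoc]
        exact dvd_mul_right _ _

lemma natGen_dvd_of_dvd_natGen_mul {i j : ℕ} (hij : i + 2 ≤ j) (hj : j < N)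
    {x : BraidMonoid N} (h : natGen N j ∣ natGen N i * x) : natGen N j ∣ x := by
  obtain ⟨y, hy⟩ := h
  rw [natGen_of_lt hj, natGen_of_lt (show i < N by omega)] at *
  obtain ⟨w, hw, -⟩ := (cofactorBelow N _).far (Nat.lt_succ_self _) hy (.inl hij)
  exact ⟨w, hw⟩

lemma natGen_dvd_of_dvd_up_mul {m j : ℕ} (hmj : m + 1 ≤ j) (hj : j < N)
    {x : BraidMonoid N} (h : natGen N j ∣ up N m * x) : natGen N j ∣ x := by
  induction m generalizing x with
  | zero => simpa [up] using h
  | succ m ih =>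
    rw [up, mul_assoc] at h
    exact natGen_dvd_of_dvd_natGen_mul (by omega) hj (ih (by omega) h)

lemma natGen_dvd_of_dvd_garside_mul {m j : ℕ} (hmj : m + 1 ≤ j) (hj : j < N)
    {x : BraidMonoid N} (h : natGen N j ∣ garside N m * x) : natGen N j ∣ x := by
  induction m generalizing x with
  | zero => simpa [garside] using h
  | succ m ih =>
    rw [garside, mul_assoc] at h
    exact ih (by omega) (natGen_dvd_of_dvd_up_mul hmj hj h)

lemma down_dvd_of_natGen_dvd {m : ℕ} (hm : m < N) {y : BraidMonoid N}
    (h : natGen N m ∣ garside N m * y) : down N (m + 1) ∣ y := by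
  induction m generalizing y with
  | zero => simpa [garside, down] using h
  | succ m ih =>
    rw [garside, up, mul_assoc, mul_assoc] at h
    obtain ⟨z, hz⟩ := natGen_dvd_of_dvd_up_mul le_rfl hm h
    have h1 : natGen N m = gen ⟨m, by omega⟩ := natGen_of_lt (by omega)
    have h2 : natGen N (m + 1) = gen ⟨m + 1, hm⟩ := natGen_of_lt hm
    rw [h1, h2] at hz
    obtain ⟨w, hw, -⟩ := (cofactorBelow N _).adj (Nat.lt_succ_self _) hz (.inl rfl)
    rw [← h1, ← h2] at hw
    obtain ⟨y', rfl⟩ := natGen_dvd_of_dvd_garside_mul le_rfl hm ⟨_, hw⟩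
    rw [← mul_assoc, ← (natGen_comm_garside le_rfl).eq, mul_assoc] at hw
    obtain ⟨y'', rfl⟩ := ih (by omega) ⟨w, mul_left_cancel_of_eq _ hw⟩
    exact ⟨y'', by rw [down.eq_2 N (m + 1), mul_assoc]⟩

/-- The Garside element is the least common right multiple of the generators involved. -/
lemma garside_dvd {m : ℕ} (hm : m ≤ N) {z : BraidMonoid N} (h : ∀ i < m, natGen N i ∣ z) :
    garside N m ∣ z := by
  induction m with
  | zero => exact one_dvd z
  | succ m ih =>
    obtain ⟨y, rfl⟩ := ih (by omega) fun i hi => h i (by omega)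
    rw [garside_succ']
    exact mul_dvd_mul_left _ (down_dvd_of_natGen_dvd hm (h m (Nat.lt_succ_self m)))

lemma exists_natGen_dvd {z : BraidMonoid N} (hz : z ≠ 1) : ∃ i < N, natGen N i ∣ z := by
  obtain ⟨w, rfl⟩ := PresentedMonoid.surjective_mk z
  induction w using FreeMonoid.casesOn with
  | one => exact absurd (map_one _) hz
  | of_mul i A =>
    refine ⟨i, i.2, ?_⟩
    rw [natGen_of_lt i.2, map_mul]
    exact dvd_mul_right _ _

/-- If a quasi-central `z` is divisible by a generator, then it is divisible by each adjacent
generator. -/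
lemma natGen_dvd_of_adj {i j : ℕ} (hi : i < N) (hj : j < N) (hij : i + 1 = j ∨ j + 1 = i)
    {z : BraidMonoid N} (hz : ∀ k < N, z ∣ natGen N k * z) (h : natGen N i ∣ z) :
    natGen N j ∣ z := by
  obtain ⟨w, hw⟩ := h
  obtain ⟨t, ht⟩ := hz j hj
  obtain ⟨t', ht'⟩ := hz i hi
  rw [natGen_of_lt hi, natGen_of_lt hj] at *
  have h1 : gen ⟨j, hj⟩ * z = gen ⟨i, hi⟩ * (w * t) := by rw [ht, hw, mul_assoc]
  obtain ⟨u, hu, -⟩ := (cofactorBelow N _).adj (Nat.lt_succ_self _) h1 hij.symm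
  refine ⟨u * t', gen_cancel (i := ⟨i, hi⟩) ?_⟩
  rw [ht', hu]
  simp only [mul_assoc]

lemma garside_dvd_of_dvd {z : BraidMonoid N} (hz : ∀ k < N, z ∣ natGen N k * z) (h1 : z ≠ 1) :
    garside N N ∣ z := by
  obtain ⟨i, hi, h⟩ := exists_natGen_dvd h1
  have h0 : natGen N 0 ∣ z := by
    induction i with
    | zero => exact h
    | succ i ih =>
      exact ih (by omega) (natGen_dvd_of_adj hi (by omega) (.inr rfl) hz h)
  refine garside_dvd le_rfl fun j hj => ?_
  induction j with
  | zero => exact h0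
  | succ j ih => exact natGen_dvd_of_adj (by omega) hj (.inl rfl) hz (ih (by omega))

lemma len_garside_pos (hN : 0 < N) : 0 < len (garside N N) := by
  obtain ⟨x, hx⟩ := natGen_dvd_garside hN le_rfl
  rw [hx, natGen_of_lt hN, len_mul, len_gen]
  omega

/-- Quasi-central elements are powers of the Garside element. -/
theorem eq_garside_pow (hN : 0 < N) (z : BraidMonoid N) (hz : ∀ k < N, z ∣ natGen N k * z) :
    ∃ l, z = garside N N ^ l := by
  induction hn : len z using Nat.strong_induction_on generalizing z with
  | _ n ih =>
    by_cases h1 : z = 1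
    · exact ⟨0, by simpa using h1⟩
    obtain ⟨y, rfl⟩ := garside_dvd_of_dvd hz h1
    have hl := len_garside_pos hN
    rw [len_mul] at hn
    obtain ⟨l, hl⟩ := ih (len y) (by omega) y (fun k hk => by
      obtain ⟨t, ht⟩ := hz (N - 1 - k) (by omega)
      refine ⟨t, mul_left_cancel_of_eq (garside N N) ?_⟩
      rw [← mul_assoc, natGen_mul_garside (by omega) le_rfl, mul_assoc, mul_assoc] at ht
      rwa [show N - 1 - (N - 1 - k) = k by omega] at ht) rfl
    exact ⟨l + 1, by rw [pow_succ', ← hl]⟩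

lemma natGen_comm_garside_sq {i : ℕ} (hi : i < N) :
    Commute (natGen N i) (garside N N ^ 2) := by
  rw [Commute, SemiconjBy, sq, ← mul_assoc, natGen_mul_garside hi le_rfl, mul_assoc,
    natGen_mul_garside (by omega) le_rfl, mul_assoc, show N - 1 - (N - 1 - i) = i by omega]

lemma commute_of_natGen {c : BraidMonoid N} (h : ∀ i < N, Commute (natGen N i) c)
    (z : BraidMonoid N) : Commute z c := by
  obtain ⟨w, rfl⟩ := PresentedMonoid.surjective_mk z
  induction w with
  | one => exact Commute.one_left c
  | of i =>
    have := h i i.2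
    rwa [natGen_of_lt i.2] at this
  | mul x y hx hy => rw [map_mul]; exact hx.mul_left hy

lemma commute_garside_sq (z : BraidMonoid N) : Commute z (garside N N ^ 2) :=
  commute_of_natGen (fun _ => natGen_comm_garside_sq) z

/-- The Garside element is not central. -/
lemma not_commute_garside (hN : 2 ≤ N) : ¬ Commute (natGen N 0) (garside N N) := by
  intro h
  have h1 := natGen_mul_garside (show 0 < N by omega) le_rfl
  rw [h.eq] at h1
  have h2 := mul_left_cancel_of_eq _ h1
  rw [natGen_of_lt (show 0 < N by omega), natGen_of_lt (show N - 1 - 0 < N by omega),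
    ← mul_one (gen _), ← mul_one (gen ⟨N - 1 - 0, _⟩)] at h2
  rcases cofactor_of_eq h2 with ⟨e, -⟩ | ⟨-, w, e, -⟩ | ⟨-, w, e, -⟩
  · have := congrArg Fin.val e
    simp only at this
    omega
  · have := congrArg len e
    simp only [len_mul, len_one, len_gen] at this
    omega
  · have := congrArg len e
    simp only [len_mul, len_one, len_gen] at this
    omega

/-- The submonoid of powers of the square of the Garside element is an Ore set. -/
instance : OreLocalization.OreSet (Submonoid.powers (garside N N ^ 2)) where
  ore_right_cancel r₁ r₂ s h := by
    obtain ⟨s, k, rfl⟩ := s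
    refine ⟨⟨_, k, rfl⟩, ?_⟩
    have hc (r : BraidMonoid N) : r * (garside N N ^ 2) ^ k = (garside N N ^ 2) ^ k * r :=
      (commute_garside_sq r).pow_right k
    simpa only [hc] using h
  oreNum r _ := r
  oreDenom _ s := s
  ore_eq r s := by
    obtain ⟨s, k, rfl⟩ := s
    exact ((commute_garside_sq r).pow_right k).symm

/-- The monoid of fractions of positive braids by powers of the square of the Garside element. -/
abbrev Fraction (N : ℕ) : Type :=
  OreLocalization (Submonoid.powers (garside N N ^ 2)) (BraidMonoid N)

/-- The embedding of positive braids into fractions. -/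
def toFraction (N : ℕ) : BraidMonoid N →* Fraction N := OreLocalization.numeratorHom

lemma toFraction_injective : Function.Injective (toFraction N) := by
  intro a b h
  obtain ⟨u, v, h1, h2⟩ := OreLocalization.oreDiv_eq_iff.1 h
  simp only [Submonoid.coe_one, mul_one] at h2
  subst h2
  exact (mul_left_cancel_of_eq _ h1).symm

lemma isUnit_toFraction_gen (i : Fin N) : IsUnit (toFraction N (gen i)) := by
  obtain ⟨x, hx⟩ := natGen_dvd_garside i.2 le_rfl
  rw [natGen_of_lt i.2, Fin.eta] at hx
  have hc := commute_garside_sq (gen i)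
  have h1 : gen i * (x * garside N N) = garside N N ^ 2 := by rw [sq, ← mul_assoc, ← hx]
  have h2 : x * garside N N * gen i = garside N N ^ 2 := by
    refine gen_cancel (i := i) ?_
    rw [← mul_assoc, h1, hc.eq]
  have hu : IsUnit (toFraction N (garside N N ^ 2)) :=
    OreLocalization.numerator_isUnit ⟨_, Submonoid.mem_powers _⟩
  rw [isUnit_iff_exists_and_exists]
  obtain ⟨u, hu⟩ := hu
  constructor
  · refine ⟨toFraction N (x * garside N N) * ↑u⁻¹, ?_⟩
    rw [← mul_assoc, ← map_mul, h1, ← hu, Units.mul_inv]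
  · refine ⟨↑u⁻¹ * toFraction N (x * garside N N), ?_⟩
    rw [mul_assoc, ← map_mul, h2, ← hu, Units.inv_mul]

end BraidMonoid

open BraidMonoid

lemma braidGroup_comm {n : ℕ} {i j : Fin (n - 1)} (h : (i : ℕ) + 2 ≤ j) :
    (PresentedGroup.of i * PresentedGroup.of j : BraidGroup n) =
      PresentedGroup.of j * PresentedGroup.of i :=
  PresentedGroup.mk_eq_mk_of_mul_inv_mem (.inl ⟨i, j, h, rfl⟩)

lemma braidGroup_braid {n : ℕ} {i j : Fin (n - 1)} (h : (i : ℕ) + 1 = j) :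
    (PresentedGroup.of i * PresentedGroup.of j * PresentedGroup.of i : BraidGroup n) =
      PresentedGroup.of j * PresentedGroup.of i * PresentedGroup.of j :=
  PresentedGroup.mk_eq_mk_of_mul_inv_mem (.inr ⟨i, j, h, rfl⟩)

/-- The homomorphism from positive braids to the braid group, reversing the order of the
generators. -/
def toBraidGroup (n : ℕ) : BraidMonoid (n - 1) →* BraidGroup n :=
  PresentedMonoid.lift (fun i => PresentedGroup.of i.rev) (by
    rintro _ _ (⟨i, j, h⟩ | ⟨i, j, h⟩)
    · simp only [map_mul, FreeMonoid.lift_eval_of]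
      exact (braidGroup_comm (by simp only [Fin.val_rev]; omega)).symm
    · simp only [map_mul, FreeMonoid.lift_eval_of]
      exact (braidGroup_braid (by simp only [Fin.val_rev]; omega)).symm)

lemma toBraidGroup_gen {n : ℕ} (i : Fin (n - 1)) :
    toBraidGroup n (gen i) = PresentedGroup.of i.rev := rfl

/-- The homomorphism from the braid group to units of the fractions of positive braids. -/
noncomputable def braidGroupToFraction (n : ℕ) : BraidGroup n →* (Fraction (n - 1))ˣ :=
  PresentedGroup.toGroup (f := fun i => (isUnit_toFraction_gen i.rev).unit) (by
    rintro _ (⟨i, j, h, rfl⟩ | ⟨i, j, h, rfl⟩)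
    · simp only [map_mul, map_inv, FreeGroup.lift_apply_of]
      rw [mul_inv_eq_one]
      ext
      simp only [Units.val_mul, IsUnit.unit_spec, ← map_mul]
      rw [gen_comm (by simp only [Fin.val_rev]; omega)]
    · simp only [map_mul, map_inv, FreeGroup.lift_apply_of]
      rw [mul_inv_eq_one]
      ext
      simp only [Units.val_mul, IsUnit.unit_spec, ← map_mul]
      rw [mul_assoc, gen_braid (by simp only [Fin.val_rev]; omega), mul_assoc])

lemma braidGroupToFraction_toBraidGroup (n : ℕ) (a : BraidMonoid (n - 1)) :
    (braidGroupToFraction n (toBraidGroup n a) : Fraction (n - 1)) = toFraction (n - 1) a := by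
  have : ((Units.coeHom _).comp (braidGroupToFraction n)).comp (toBraidGroup n) =
      toFraction (n - 1) := by
    refine PresentedMonoid.ext _ fun i => ?_
    change (braidGroupToFraction n (PresentedGroup.of i.rev) : Fraction (n - 1)) =
      toFraction (n - 1) (gen i)
    rw [braidGroupToFraction, PresentedGroup.toGroup.of, IsUnit.unit_spec, Fin.rev_rev]
  exact DFunLike.congr_fun this a

/-- Positive braids embed in the braid group. -/
theorem toBraidGroup_injective (n : ℕ) : Function.Injective (toBraidGroup n) := by
  intro a b h
  apply toFraction_injective
  rw [← braidGroupToFraction_toBraidGroup, h, braidGroupToFraction_toBraidGroup]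

lemma toBraidGroup_natGen {n i : ℕ} (hi : i < n - 1) :
    toBraidGroup n (natGen (n - 1) i) = sigmaB n (n - 2 - i) := by
  rw [natGen_of_lt hi, toBraidGroup_gen, sigmaB, dif_pos (by omega)]
  congr 1
  ext
  simp only [Fin.val_rev]
  omega

lemma toBraidGroup_up {n m : ℕ} (hm : m ≤ n - 1) :
    toBraidGroup n (up (n - 1) m) =
      ((List.range m).map fun j => sigmaB n (n - 2 - j)).prod := by
  induction m with
  | zero => simp [up]
  | succ m ih =>
    rw [up, map_mul, ih (by omega), toBraidGroup_natGen hm, List.range_succ, List.map_append,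
      List.prod_append, List.map_singleton, List.prod_singleton]

lemma toBraidGroup_garside (n : ℕ) :
    toBraidGroup n (garside (n - 1) (n - 1)) = deltaB n := by
  have key : ∀ m ≤ n - 1, toBraidGroup n (garside (n - 1) m) =
      ((List.range m).map fun k =>
        ((List.range (m - k)).map fun j => sigmaB n (n - 2 - j)).prod).prod := by
    intro m hm
    induction m with
    | zero => simp [garside]
    | succ m ih =>
      rw [garside, map_mul, ih (by omega), toBraidGroup_up hm, List.range_succ_eq_map,
        List.map_cons, List.prod_cons, List.map_map]
      simp [Function.comp_def, List.range_succ_eq_map]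
  exact key _ le_rfl

lemma commute_deltaB_sq {n : ℕ} (g : BraidGroup n) : Commute g (deltaB n ^ 2) := by
  have hgen (i : Fin (n - 1)) : Commute (PresentedGroup.of i : BraidGroup n) (deltaB n ^ 2) := by
    rw [← toBraidGroup_garside, ← map_pow, ← Fin.rev_rev i, ← toBraidGroup_gen]
    exact (commute_garside_sq _).map _
  obtain ⟨w, rfl⟩ := PresentedGroup.mk_surjective _ g
  induction w using FreeGroup.induction_on with
  | C1 => exact Commute.one_left _
  | of i => exact hgen i
  | inv_of i _ => exact (hgen i).inv_left
  | mul x y hx hy => rw [map_mul]; exact hx.mul_left hy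

/-- Every braid becomes positive after multiplication by a power of `Δ²`. -/
lemma exists_mul_deltaB_pow {n : ℕ} (g : BraidGroup n) :
    ∃ k a, g * (deltaB n ^ 2) ^ k = toBraidGroup n a := by
  obtain ⟨w, rfl⟩ := PresentedGroup.mk_surjective _ g
  induction w using FreeGroup.induction_on with
  | C1 => exact ⟨0, 1, by simp⟩
  | of i =>
    refine ⟨0, gen i.rev, ?_⟩
    rw [toBraidGroup_gen, Fin.rev_rev, pow_zero, mul_one]
    rfl
  | inv_of i _ =>
    obtain ⟨x, hx⟩ := natGen_dvd_garside i.rev.2 le_rfl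
    rw [natGen_of_lt i.rev.2, Fin.eta] at hx
    refine ⟨1, x * garside (n - 1) (n - 1), ?_⟩
    rw [map_inv, inv_mul_eq_iff_eq_mul, pow_one, ← toBraidGroup_garside, ← map_pow, sq]
    conv_lhs => enter [2, 1]; rw [hx]
    rw [mul_assoc, map_mul, toBraidGroup_gen, Fin.rev_rev]
    rfl
  | mul x y hx hy =>
    obtain ⟨k, a, ha⟩ := hx
    obtain ⟨l, b, hb⟩ := hy
    refine ⟨k + l, a * b, ?_⟩
    rw [map_mul, map_mul, ← ha, ← hb, pow_add, mul_assoc, mul_assoc,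
      ← mul_assoc _ _ (_ ^ l), ((commute_deltaB_sq _).pow_right k).eq, mul_assoc]

/-- For `n ≥ 3`, the center of the braid group `Bₙ` is the infinite cyclic subgroup
generated by `Δₙ²`: it equals the set of integer powers of `Δₙ²`, and `Δₙ²` has
infinite order. -/
theorem braid_center_eq_zpowers_delta_sq (n : ℕ) (hn : 3 ≤ n) :
    Subgroup.center (BraidGroup n) = Subgroup.zpowers (deltaB n ^ 2) ∧
    ¬ IsOfFinOrder (deltaB n ^ 2) := by
  have hcomm_pow (k : ℤ) (g : BraidGroup n) : Commute g ((deltaB n ^ 2) ^ k) :=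
    (commute_deltaB_sq g).zpow_right k
  refine ⟨le_antisymm (fun z hz => ?_) ?_, ?_⟩
  · rw [Subgroup.mem_center_iff] at hz
    obtain ⟨k, a, ha⟩ := exists_mul_deltaB_pow z
    have hz' (g : BraidGroup n) : Commute g (toBraidGroup n a) := by
      rw [← ha]
      exact Commute.mul_right (hz g) ((commute_deltaB_sq g).pow_right k)
    obtain ⟨l, rfl⟩ := eq_garside_pow (by omega) a fun i _ =>
      ⟨natGen (n - 1) i, toBraidGroup_injective n (by rw [map_mul, map_mul]; exact hz' _)⟩
    rw [map_pow, toBraidGroup_garside] at ha hz'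
    rcases Nat.even_or_odd' l with ⟨m, rfl | rfl⟩
    · refine ⟨(m : ℤ) - k, ?_⟩
      simp only
      rw [zpow_sub, zpow_natCast, zpow_natCast, ← pow_mul, ← ha, mul_inv_cancel_right]
    · exfalso
      refine not_commute_garside (N := n - 1) (by omega) (toBraidGroup_injective n ?_)
      rw [map_mul, map_mul, toBraidGroup_garside]
      have h := hz' (toBraidGroup n (natGen (n - 1) 0))
      rw [pow_succ', pow_mul] at h
      have h2 := h.mul_right ((commute_deltaB_sq _).pow_right m).inv_right
      rwa [mul_inv_cancel_right] at h2
  · rintro _ ⟨k, rfl⟩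
    rw [Subgroup.mem_center_iff]
    exact fun g => hcomm_pow k g
  · rw [isOfFinOrder_iff_pow_eq_one]
    rintro ⟨k, hk, h⟩
    rw [← toBraidGroup_garside, ← map_pow, ← map_pow] at h
    have h1 := toBraidGroup_injective n (h.trans (map_one _).symm)
    have hpos := len_garside_pos (N := n - 1) (by omega)
    obtain ⟨k, rfl⟩ := Nat.exists_eq_succ_of_ne_zero hk.ne'
    have h2 := congrArg len h1
    rw [pow_succ, sq, len_mul, len_mul, len_one] at h2
    omega
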